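/- Assume (A2) and the normalization ψ(ξ) = 1 for |ξ| = 1. Let Γ ⊂ ℝ^d be open and x ∈ Γ. For s ≥ 1 set ν^s(z) = s · ψ^{-1}(1/s)^{-d} · ν(z/ψ^{-1}(1/s)) and κ_Γ^s(x) = ∫_{Γ^c} ν^s(y − x) dy. Then lim_{s→∞} κ_Γ^s(x) = ∫_{Γ^c} 𝒜(d,α)·|y − x|^{-d-α} dy, and both sides are finite. -/

import Mathlib

open MeasureTheory Filter Real
open scoped RealInnerProductSpace

noncomputable section

/-- Pruitt's concentration function `K(r) = r⁻² ∫_{|z|<r} |z|² ν(|z|) dz`. -/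
def K (d : ℕ) (ν : ℝ → ℝ) (r : ℝ) : ℝ :=
  (∫ z in Metric.ball (0 : EuclideanSpace ℝ (Fin d)) r, ‖z‖ ^ 2 * ν ‖z‖) / r ^ 2

/-- Pruitt's concentration function `h(r) = ∫ (|z|²/r² ∧ 1) ν(|z|) dz`. -/
def hfun (d : ℕ) (ν : ℝ → ℝ) (r : ℝ) : ℝ :=
  ∫ z : EuclideanSpace ℝ (Fin d), min (‖z‖ ^ 2 / r ^ 2) 1 * ν ‖z‖

/-- The characteristic (Lévy–Khintchine) exponent `ψ(ξ) = ∫ (1 - cos⟪ξ,z⟫) ν(|z|) dz`. -/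
def ψ (d : ℕ) (ν : ℝ → ℝ) (ξ : EuclideanSpace ℝ (Fin d)) : ℝ :=
  ∫ z : EuclideanSpace ℝ (Fin d), (1 - Real.cos ⟪ξ, z⟫) * ν ‖z‖

/-- The radial nondecreasing majorant `ψ*(r) = sup_{|z| ≤ r} ψ(z)`. -/
def ψstar (d : ℕ) (ν : ℝ → ℝ) (r : ℝ) : ℝ :=
  sSup {y : ℝ | ∃ z : EuclideanSpace ℝ (Fin d), ‖z‖ ≤ r ∧ ψ d ν z = y}

/-- The generalized inverse `ψ⁻¹(u) = sup {r ≥ 0 : ψ*(r) = u}`. -/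
def ψinv (d : ℕ) (ν : ℝ → ℝ) (u : ℝ) : ℝ :=
  sSup {r : ℝ | 0 ≤ r ∧ ψstar d ν r = u}

/-- Characteristic exponent `ψˢ(ξ) = s·ψ(ψ⁻¹(1/s)ξ)` of the rescaled process. -/
def ψs (d : ℕ) (ν : ℝ → ℝ) (s : ℝ) (ξ : EuclideanSpace ℝ (Fin d)) : ℝ :=
  s * ψ d ν (ψinv d ν (1 / s) • ξ)

/-- Lévy density `νˢ(x) = s·ψ⁻¹(1/s)^{-d}·ν(x/ψ⁻¹(1/s))` of the rescaled process. -/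
def νs (d : ℕ) (ν : ℝ → ℝ) (s : ℝ) (x : EuclideanSpace ℝ (Fin d)) : ℝ :=
  s / ψinv d ν (1 / s) ^ d * ν (‖x‖ / ψinv d ν (1 / s))

/-- `ψ^{-1,s}(u) = ψ⁻¹(u/s)/ψ⁻¹(1/s)`. -/
def ψinvs (d : ℕ) (ν : ℝ → ℝ) (s u : ℝ) : ℝ :=
  ψinv d ν (u / s) / ψinv d ν (1 / s)

/-- The stable constant `𝒜(d,α)`. -/
def Aconst (d : ℕ) (α : ℝ) : ℝ :=
  α * (2 : ℝ) ^ (α - 1) * Real.Gamma (((d : ℝ) + α) / 2) /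
    (Real.Gamma (1 - α / 2) * Real.pi ^ ((d : ℝ) / 2))

/-- Heat kernel of the rescaled process, via Fourier inversion. -/
def pts (d : ℕ) (ν : ℝ → ℝ) (s t : ℝ) (x : EuclideanSpace ℝ (Fin d)) : ℝ :=
  ((2 * Real.pi) ^ d)⁻¹ *
    ∫ ξ : EuclideanSpace ℝ (Fin d), Real.cos ⟪ξ, x⟫ * Real.exp (-(t * ψs d ν s ξ))

/-- Heat kernel of the isotropic α-stable process. -/
def ptα (d : ℕ) (α t : ℝ) (x : EuclideanSpace ℝ (Fin d)) : ℝ :=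
  ((2 * Real.pi) ^ d)⁻¹ *
    ∫ ξ : EuclideanSpace ℝ (Fin d), Real.cos ⟪ξ, x⟫ * Real.exp (-(t * ‖ξ‖ ^ α))

/-- Heat kernel of the original process, via Fourier inversion. -/
def pt (d : ℕ) (ν : ℝ → ℝ) (t : ℝ) (x : EuclideanSpace ℝ (Fin d)) : ℝ :=
  ((2 * Real.pi) ^ d)⁻¹ *
    ∫ ξ : EuclideanSpace ℝ (Fin d), Real.cos ⟪ξ, x⟫ * Real.exp (-(t * ψ d ν ξ))

/-- Tonelli's theorem for Bochner integrals of nonnegative functions whose sections are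
integrable. -/
lemma integral_integral_swap_of_nonneg {X Y : Type*} [MeasurableSpace X] [MeasurableSpace Y]
    {μ : Measure X} {ρ : Measure Y} [SFinite μ] [SFinite ρ] {f : X → Y → ℝ}
    (hf : AEStronglyMeasurable (Function.uncurry f) (μ.prod ρ))
    (hnn : ∀ᵐ x ∂μ, ∀ᵐ y ∂ρ, 0 ≤ f x y) (hnn' : ∀ᵐ y ∂ρ, ∀ᵐ x ∂μ, 0 ≤ f x y)
    (h1 : ∀ᵐ x ∂μ, Integrable (f x) ρ) (h2 : ∀ᵐ y ∂ρ, Integrable (fun x => f x y) μ) :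
    ∫ x, ∫ y, f x y ∂ρ ∂μ = ∫ y, ∫ x, f x y ∂μ ∂ρ := by
  rw [integral_eq_lintegral_of_nonneg_ae, integral_eq_lintegral_of_nonneg_ae]
  · congr 1
    have e1 : ∫⁻ x, ENNReal.ofReal (∫ y, f x y ∂ρ) ∂μ
        = ∫⁻ x, ∫⁻ y, ENNReal.ofReal (f x y) ∂ρ ∂μ := by
      refine lintegral_congr_ae ?_
      filter_upwards [h1, hnn] with x hx hx'
      exact ofReal_integral_eq_lintegral_ofReal hx hx'
    have e2 : ∫⁻ y, ENNReal.ofReal (∫ x, f x y ∂μ) ∂ρ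
        = ∫⁻ y, ∫⁻ x, ENNReal.ofReal (f x y) ∂μ ∂ρ := by
      refine lintegral_congr_ae ?_
      filter_upwards [h2, hnn'] with x hx hx'
      exact ofReal_integral_eq_lintegral_ofReal hx hx'
    rw [e1, e2]
    exact lintegral_lintegral_swap hf.aemeasurable.ennreal_ofReal
  · filter_upwards [hnn'] with y hy using integral_nonneg_of_ae hy
  · exact hf.prod_swap.integral_prod_right'
  · filter_upwards [hnn] with y hy using integral_nonneg_of_ae hy
  · exact hf.integral_prod_right'

lemma integral_one_sub_cos_mul_gaussian {d : ℕ} {e : EuclideanSpace ℝ (Fin d)} (he : ‖e‖ = 1)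
    {t : ℝ} (ht : 0 < t) :
    Integrable (fun w : EuclideanSpace ℝ (Fin d) =>
        (1 - Real.cos ⟪e, w⟫) * Real.exp (-(t * ‖w‖ ^ 2))) ∧
    ∫ w : EuclideanSpace ℝ (Fin d), (1 - Real.cos ⟪e, w⟫) * Real.exp (-(t * ‖w‖ ^ 2)) =
      (π / t) ^ ((d : ℝ) / 2) * (1 - Real.exp (-(1 / (4 * t)))) := by
  have hb : 0 < (t : ℂ).re := by simpa using ht
  have key : ∀ c : ℂ, ∀ w : EuclideanSpace ℝ (Fin d),
      (Complex.exp (-(t : ℂ) * ‖w‖ ^ 2 + c * (⟪e, w⟫ : ℝ))) =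
      (Real.exp (-(t * ‖w‖ ^ 2)) : ℝ) * Complex.exp (c * (⟪e, w⟫ : ℝ)) := by
    intro c w
    rw [Complex.exp_add]; push_cast; congr 2; ring
  have hre : ∀ w : EuclideanSpace ℝ (Fin d),
      (1 - Real.cos ⟪e, w⟫) * Real.exp (-(t * ‖w‖ ^ 2)) =
      (Complex.exp (-(t : ℂ) * ‖w‖ ^ 2 + (0 : ℂ) * (⟪e, w⟫ : ℝ)) -
        Complex.exp (-(t : ℂ) * ‖w‖ ^ 2 + Complex.I * (⟪e, w⟫ : ℝ))).re := by
    intro w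
    rw [key, key, Complex.sub_re, Complex.re_ofReal_mul, Complex.re_ofReal_mul,
      mul_comm Complex.I, Complex.exp_ofReal_mul_I_re]
    simp; ring
  have i0 := GaussianFourier.integrable_cexp_neg_mul_sq_norm_add hb 0 e
  have i1 := GaussianFourier.integrable_cexp_neg_mul_sq_norm_add hb Complex.I e
  have hpow : ((π : ℂ) / t) ^ ((Module.finrank ℝ (EuclideanSpace ℝ (Fin d)) : ℂ) / 2)
      = (((π / t) ^ ((d : ℝ) / 2) : ℝ) : ℂ) := by
    rw [Complex.ofReal_cpow (by positivity)]; simp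
  simp_rw [hre]
  refine ⟨(i0.sub i1).re, ?_⟩
  have := integral_re (i0.sub i1)
  simp only [Pi.sub_apply, RCLike.re_to_complex] at this
  rw [this, integral_sub i0 i1, GaussianFourier.integral_cexp_neg_mul_sq_norm_add hb,
    GaussianFourier.integral_cexp_neg_mul_sq_norm_add hb, hpow, ← mul_sub, Complex.re_ofReal_mul,
    he]
  congr 1
  have : (Complex.I ^ 2 * ((1 : ℝ) : ℂ) ^ 2 / (4 * (t : ℂ))) = ((-(1 / (4 * t)) : ℝ) : ℂ) := by
    push_cast; rw [Complex.I_sq]; ring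
  rw [this, Complex.sub_re, Complex.exp_ofReal_re]
  simp

lemma integral_rpow_mul_one_sub_exp {α : ℝ} (hα : 0 < α) (hα2 : α < 2) :
    ∫ t in Set.Ioi (0 : ℝ), t ^ (α / 2 - 1) * (1 - Real.exp (-(1 / (4 * t)))) =
      2 / α * (4 : ℝ) ^ (-(α / 2)) * Real.Gamma (1 - α / 2) := by
  let S : Set (ℝ × ℝ) := {q | 0 < q.1 ∧ 0 < q.2 ∧ 4 * q.1 * q.2 ≤ 1}
  have hS : MeasurableSet S := by
    have hm : Measurable fun q : ℝ × ℝ => 4 * q.1 * q.2 := by fun_prop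
    exact ((measurableSet_lt measurable_const measurable_fst).inter
      ((measurableSet_lt measurable_const measurable_snd).inter
      (measurableSet_le hm measurable_const)))
  let f : ℝ → ℝ → ℝ := fun t v =>
    S.indicator (fun q => q.1 ^ (α / 2 - 1) * Real.exp (-q.2)) (t, v)
  have ft : ∀ t, 0 < t → f t = (Set.Ioc 0 (1 / (4 * t))).indicator
      (fun v => t ^ (α / 2 - 1) * Real.exp (-v)) := by
    intro t ht
    ext v
    have : (t, v) ∈ S ↔ v ∈ Set.Ioc 0 (1 / (4 * t)) := by
      simp only [S, Set.mem_ofPred_eq, Set.mem_Ioc, ht, true_and,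
        le_div_iff₀ (by positivity : 0 < 4 * t)]
      rw [mul_comm v]
    simp only [f, Set.indicator, this]
  have fv : ∀ v, 0 < v → (fun t => f t v) = (Set.Ioc 0 (1 / (4 * v))).indicator
      (fun t => t ^ (α / 2 - 1) * Real.exp (-v)) := by
    intro v hv
    ext t
    have : (t, v) ∈ S ↔ t ∈ Set.Ioc 0 (1 / (4 * v)) := by
      simp only [S, Set.mem_ofPred_eq, Set.mem_Ioc, hv, true_and,
        le_div_iff₀ (by positivity : 0 < 4 * v)]
      rw [show 4 * t * v = t * (4 * v) by ring]
    simp only [f, Set.indicator, this]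
  have hnn : ∀ t v, 0 ≤ f t v := by
    intro t v
    refine Set.indicator_nonneg (fun q hq => ?_) _
    have := hq.1
    positivity
  have hswap : ∫ t in Set.Ioi (0 : ℝ), ∫ v in Set.Ioi (0 : ℝ), f t v =
      ∫ v in Set.Ioi (0 : ℝ), ∫ t in Set.Ioi (0 : ℝ), f t v := by
    refine integral_integral_swap_of_nonneg ?_ (by simp [hnn]) (by simp [hnn]) ?_ ?_
    · have hm : Measurable fun q : ℝ × ℝ => q.1 ^ (α / 2 - 1) * Real.exp (-q.2) := by fun_prop
      exact (hm.indicator hS).aestronglyMeasurable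
    · filter_upwards [ae_restrict_mem measurableSet_Ioi] with t ht
      rw [ft t ht]
      refine (IntegrableOn.integrable_indicator ?_ measurableSet_Ioc).integrableOn
      exact (Continuous.integrableOn_Icc (by fun_prop)).mono_set Set.Ioc_subset_Icc_self
    · filter_upwards [ae_restrict_mem measurableSet_Ioi] with v hv
      have hv' : (0 : ℝ) < v := hv
      rw [fv v hv]
      refine (IntegrableOn.integrable_indicator ?_ measurableSet_Ioc).integrableOn
      refine Integrable.mul_const ?_ _
      exact (intervalIntegral.intervalIntegrable_rpow' (by linarith)).1
  have l : ∀ t ∈ Set.Ioi (0 : ℝ), ∫ v in Set.Ioi (0 : ℝ), f t v =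
      t ^ (α / 2 - 1) * (1 - Real.exp (-(1 / (4 * t)))) := by
    intro t ht
    have ht' : (0 : ℝ) < t := ht
    rw [ft t ht, setIntegral_indicator measurableSet_Ioc,
      Set.inter_eq_right.2 Set.Ioc_subset_Ioi_self,
      ← intervalIntegral.integral_of_le (by positivity), intervalIntegral.integral_const_mul]
    congr 1
    rw [intervalIntegral.integral_comp_neg (fun x => Real.exp x)]
    simp
  have r : ∀ v ∈ Set.Ioi (0 : ℝ), ∫ t in Set.Ioi (0 : ℝ), f t v =
      2 / α * (4 : ℝ) ^ (-(α / 2)) * (Real.exp (-v) * v ^ ((1 - α / 2) - 1)) := by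
    intro v hv
    have hv' : (0 : ℝ) < v := hv
    rw [fv v hv, setIntegral_indicator measurableSet_Ioc,
      Set.inter_eq_right.2 Set.Ioc_subset_Ioi_self,
      ← intervalIntegral.integral_of_le (by positivity), intervalIntegral.integral_mul_const,
      integral_rpow (Or.inl (by linarith)), Real.zero_rpow (by linarith)]
    have : (1 / (4 * v)) ^ (α / 2 - 1 + 1) = 4 ^ (-(α / 2)) * v ^ (1 - α / 2 - 1) := by
      rw [one_div, Real.inv_rpow (by positivity), ← Real.rpow_neg (by positivity),
        Real.mul_rpow (by positivity) hv'.le]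
      congr 2 <;> ring
    rw [this, show α / 2 - 1 + 1 = α / 2 by ring]
    generalize (4 : ℝ) ^ (-(α / 2)) = A
    generalize v ^ (1 - α / 2 - 1) = B
    field_simp
    ring
  rw [setIntegral_congr_fun measurableSet_Ioi l, setIntegral_congr_fun measurableSet_Ioi r,
    integral_const_mul, ← Real.Gamma_eq_integral (by linarith)] at hswap
  exact hswap

/-- The Lévy–Khintchine integral of the isotropic stable density. -/
lemma integral_one_sub_cos_mul_rpow {d : ℕ} (hd : 1 ≤ d) {α : ℝ} (hα : 0 < α) (hα2 : α < 2)
    {e : EuclideanSpace ℝ (Fin d)} (he : ‖e‖ = 1) :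
    ∫ w : EuclideanSpace ℝ (Fin d), (1 - Real.cos ⟪e, w⟫) * ‖w‖ ^ (-(d : ℝ) - α) =
      (Aconst d α)⁻¹ := by
  have : Nonempty (Fin d) := ⟨⟨0, hd⟩⟩
  set p : ℝ := ((d : ℝ) + α) / 2 with hp
  have hp0 : 0 < p := by positivity
  let f : EuclideanSpace ℝ (Fin d) → ℝ → ℝ := fun w t =>
    (1 - Real.cos ⟪e, w⟫) * (t ^ (p - 1) * Real.exp (-(‖w‖ ^ 2 * t)))
  have hne : ∀ᵐ w : EuclideanSpace ℝ (Fin d), w ≠ 0 := by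
    rw [ae_iff]; simp
  have hcos : ∀ w : EuclideanSpace ℝ (Fin d), 0 ≤ 1 - Real.cos ⟪e, w⟫ :=
    fun w => sub_nonneg.2 (Real.cos_le_one _)
  have l : ∀ w : EuclideanSpace ℝ (Fin d), w ≠ 0 → ∫ t in Set.Ioi (0 : ℝ), f w t =
      Real.Gamma p * ((1 - Real.cos ⟪e, w⟫) * ‖w‖ ^ (-(d : ℝ) - α)) := by
    intro w hw
    have hw' : 0 < ‖w‖ := norm_pos_iff.2 hw
    simp only [f]
    rw [integral_const_mul, Real.integral_rpow_mul_exp_neg_mul_Ioi hp0 (by positivity)]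
    have : (1 / ‖w‖ ^ 2) ^ p = ‖w‖ ^ (-(d : ℝ) - α) := by
      rw [one_div, Real.inv_rpow (by positivity), ← Real.rpow_neg (by positivity),
        ← Real.rpow_natCast, ← Real.rpow_mul hw'.le]
      congr 1; rw [hp]; push_cast; ring
    rw [this]; ring
  have hf_eq : ∀ t, (fun w => f w t) = fun w =>
      t ^ (p - 1) * ((1 - Real.cos ⟪e, w⟫) * Real.exp (-(t * ‖w‖ ^ 2))) := by
    intro t; ext w; simp only [f]; rw [mul_comm (‖w‖ ^ 2)]; ring
  have r : ∀ t ∈ Set.Ioi (0 : ℝ), ∫ w, f w t =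
      π ^ ((d : ℝ) / 2) * (t ^ (α / 2 - 1) * (1 - Real.exp (-(1 / (4 * t))))) := by
    intro t ht
    have ht' : (0 : ℝ) < t := ht
    rw [hf_eq, integral_const_mul, (integral_one_sub_cos_mul_gaussian he ht').2,
      Real.div_rpow Real.pi_pos.le ht'.le]
    have : t ^ (p - 1) = t ^ (α / 2 - 1) * t ^ ((d : ℝ) / 2) := by
      rw [← Real.rpow_add ht']; congr 1; rw [hp]; ring
    rw [this]
    have : 0 < t ^ ((d : ℝ) / 2) := by positivity
    field_simp
  have hswap : ∫ w, ∫ t in Set.Ioi (0 : ℝ), f w t = ∫ t in Set.Ioi (0 : ℝ), ∫ w, f w t := by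
    have hnn : ∀ w, ∀ t ∈ Set.Ioi (0 : ℝ), 0 ≤ f w t := by
      intro w t ht
      have ht' : (0 : ℝ) < t := ht
      have := hcos w
      simp only [f]; positivity
    refine integral_integral_swap_of_nonneg ?_ ?_ ?_ ?_ ?_
    · refine Measurable.aestronglyMeasurable ?_
      simp only [f, Function.uncurry_def]
      fun_prop
    · refine Eventually.of_forall fun w => ?_
      filter_upwards [ae_restrict_mem measurableSet_Ioi] with t ht using hnn w t ht
    · filter_upwards [ae_restrict_mem measurableSet_Ioi] with t ht
      exact Eventually.of_forall fun w => hnn w t ht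
    · filter_upwards [hne] with w hw
      have hw' : 0 < ‖w‖ := norm_pos_iff.2 hw
      refine Integrable.const_mul ?_ _
      refine Integrable.of_integral_ne_zero ?_
      rw [Real.integral_rpow_mul_exp_neg_mul_Ioi hp0 (by positivity)]
      have := Real.Gamma_pos_of_pos hp0
      positivity
    · filter_upwards [ae_restrict_mem measurableSet_Ioi] with t ht
      rw [hf_eq]
      exact (integral_one_sub_cos_mul_gaussian he ht).1.const_mul _
  rw [setIntegral_congr_fun measurableSet_Ioi r, integral_const_mul,
    integral_rpow_mul_one_sub_exp hα hα2,
    integral_congr_ae (hne.mono l), integral_const_mul] at hswap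
  have hG := Real.Gamma_pos_of_pos hp0
  have hG2 : 0 < Real.Gamma (1 - α / 2) := Real.Gamma_pos_of_pos (by linarith)
  have h2 : (2 : ℝ) ^ (α - 1) = ((2 : ℝ) * 4 ^ (-(α / 2)))⁻¹ := by
    rw [show (4 : ℝ) = 2 ^ (2 : ℝ) by norm_num, ← Real.rpow_mul (by norm_num), mul_inv,
      ← Real.rpow_neg (by norm_num), Real.rpow_sub (by norm_num)]
    rw [show -(2 * -(α / 2)) = α by ring, Real.rpow_one]; ring
  have h4 : (0 : ℝ) < 4 ^ (-(α / 2)) := by positivity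
  rw [← mul_right_inj' hG.ne', hswap, Aconst, h2, ← hp]
  field_simp

lemma aestronglyMeasurable_comp_mul_norm {d : ℕ} (hd : 1 ≤ d) {ν : ℝ → ℝ}
    (hν_mono : ∀ r₁ r₂ : ℝ, 0 < r₁ → r₁ ≤ r₂ → ν r₂ ≤ ν r₁) {c : ℝ} (hc : 0 < c) :
    AEStronglyMeasurable (fun z : EuclideanSpace ℝ (Fin d) => ν (c * ‖z‖)) := by
  have : Nonempty (Fin d) := ⟨⟨0, hd⟩⟩
  have hm : Measurable ((Set.Ioi (0 : ℝ)).indicator (fun r => ν r - ν 1)) := by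
    refine measurable_of_Ioi fun t => ?_
    have hoc : ∀ q : ℝ, MeasurableSet {r : ℝ | 0 < r ∧ q < ν r} := fun q => by
      refine Set.OrdConnected.measurableSet ⟨fun x hx y hy z hz => ?_⟩
      exact ⟨hx.1.trans_le hz.1, hy.2.trans_le (hν_mono z y (hx.1.trans_le hz.1) hz.2)⟩
    by_cases ht : t < 0
    · have : (Set.Ioi (0 : ℝ)).indicator (fun r => ν r - ν 1) ⁻¹' Set.Ioi t =
          Set.Iic 0 ∪ {r : ℝ | 0 < r ∧ t + ν 1 < ν r} := by
        ext r
        by_cases hr : 0 < r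
        · simp [hr, not_le.2 hr, lt_sub_iff_add_lt]
        · simp [hr, not_lt.1 hr, ht]
      rw [this]
      exact measurableSet_Iic.union (hoc _)
    · have : (Set.Ioi (0 : ℝ)).indicator (fun r => ν r - ν 1) ⁻¹' Set.Ioi t =
          {r : ℝ | 0 < r ∧ t + ν 1 < ν r} := by
        ext r
        by_cases hr : 0 < r
        · simp [hr, lt_sub_iff_add_lt]
        · simp [hr, ht]
      rw [this]
      exact hoc _
  have h2 : Measurable fun z : EuclideanSpace ℝ (Fin d) =>
      (Set.Ioi (0 : ℝ)).indicator (fun r => ν r - ν 1) (c * ‖z‖) + ν 1 :=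
    (hm.comp (by fun_prop)).add_const _
  refine h2.aestronglyMeasurable.congr ?_
  have hne : ∀ᵐ w : EuclideanSpace ℝ (Fin d), w ≠ 0 := by rw [ae_iff]; simp
  filter_upwards [hne] with w hw
  have hw' : 0 < c * ‖w‖ := mul_pos hc (norm_pos_iff.2 hw)
  simp [Set.indicator_of_mem (Set.mem_Ioi.2 hw')]

lemma integrable_min_sq_mul_rpow_norm {d : ℕ} (hd : 1 ≤ d) {p : ℝ} (hp : d < p)
    (hp2 : p < d + 2) :
    Integrable (fun w : EuclideanSpace ℝ (Fin d) => min (‖w‖ ^ 2) 1 * ‖w‖ ^ (-p)) := by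
  have : Nonempty (Fin d) := ⟨⟨0, hd⟩⟩
  have hd' : ((d - 1 : ℕ) : ℝ) = (d : ℝ) - 1 := by push_cast [hd]; ring
  rw [integrable_fun_norm_addHaar volume (f := fun r : ℝ => min (r ^ 2) 1 * r ^ (-p))]
  simp only [finrank_euclideanSpace, Fintype.card_fin, smul_eq_mul]
  rw [← Set.Ioc_union_Ioi_eq_Ioi zero_le_one, integrableOn_union]
  constructor
  · have h : IntegrableOn (fun r : ℝ => r ^ ((d : ℝ) + 1 - p)) (Set.Ioc 0 1) :=
      (intervalIntegral.intervalIntegrable_rpow' (by linarith)).1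
    refine h.congr_fun (fun r hr => ?_) measurableSet_Ioc
    have hr0 := hr.1
    have : r ^ 2 ≤ 1 := pow_le_one₀ hr0.le hr.2
    simp only [min_eq_left this]
    rw [← Real.rpow_natCast r (d - 1), ← Real.rpow_natCast r 2, ← Real.rpow_add hr0,
      ← Real.rpow_add hr0, hd']
    congr 1; push_cast; ring
  · have h : IntegrableOn (fun r : ℝ => r ^ ((d : ℝ) - 1 - p)) (Set.Ioi 1) :=
      integrableOn_Ioi_rpow_of_lt (by linarith) one_pos
    refine h.congr_fun (fun r hr => ?_) measurableSet_Ioi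
    have hr1 : (1 : ℝ) < r := hr
    have hr0 : 0 < r := one_pos.trans hr1
    have : 1 ≤ r ^ 2 := one_le_pow₀ hr1.le
    simp only [min_eq_right this]
    rw [← Real.rpow_natCast r (d - 1), one_mul, ← Real.rpow_add hr0, hd']
    congr 1

/-- Potter's bounds for a non-increasing function which is regularly varying along powers
of two. -/
lemma exists_potter_bound {ν : ℝ → ℝ} (hν_pos : ∀ r : ℝ, 0 < r → 0 < ν r)
    (hν_mono : ∀ r₁ r₂ : ℝ, 0 < r₁ → r₁ ≤ r₂ → ν r₂ ≤ ν r₁) {a b γ : ℝ} (ha0 : 0 < a)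
    (ha : a < γ) (hb : γ < b)
    (hreg : Tendsto (fun r : ℝ => ν (2 * r) / ν r) atTop (nhds (2 ^ (-γ)))) :
    ∃ C : ℝ, 0 < C ∧ ∃ R : ℝ, 0 < R ∧ ∀ x y : ℝ, R ≤ x → R ≤ y →
      ν x ≤ C * ((x / y) ^ (-a) + (x / y) ^ (-b)) * ν y := by
  have hu := hreg.eventually_lt_const (Real.rpow_lt_rpow_of_exponent_lt one_lt_two
    (neg_lt_neg ha))
  have hl := hreg.eventually_const_lt (Real.rpow_lt_rpow_of_exponent_lt one_lt_two
    (neg_lt_neg hb))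
  obtain ⟨R₀, hR₀⟩ := eventually_atTop.1 (hu.and hl)
  set R := max R₀ 1
  have hRpos : 0 < R := lt_of_lt_of_le one_pos (le_max_right _ _)
  have hstep : ∀ r, R ≤ r → ν (2 * r) ≤ 2 ^ (-a) * ν r ∧ 2 ^ (-b) * ν r ≤ ν (2 * r) := by
    intro r hr
    have h := hR₀ r ((le_max_left _ _).trans hr)
    have hp := hν_pos r (hRpos.trans_le hr)
    exact ⟨((div_lt_iff₀ hp).1 h.1).le, ((lt_div_iff₀ hp).1 h.2).le⟩
  have hiter : ∀ n : ℕ, ∀ r, R ≤ r → ν (2 ^ n * r) ≤ ((2 : ℝ) ^ n) ^ (-a) * ν r ∧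
      ((2 : ℝ) ^ n) ^ (-b) * ν r ≤ ν (2 ^ n * r) := by
    intro n
    induction n with
    | zero => intro r _; simp
    | succ n ih =>
      intro r hr
      have h2 : R ≤ 2 ^ n * r := hr.trans
        (le_mul_of_one_le_left (hRpos.le.trans hr) (one_le_pow₀ one_le_two))
      have h := hstep _ h2
      have h' := ih r hr
      have e : (2 : ℝ) ^ (n + 1) * r = 2 * (2 ^ n * r) := by ring
      have e' : ∀ c : ℝ, ((2 : ℝ) ^ (n + 1)) ^ c = 2 ^ c * ((2 : ℝ) ^ n) ^ c := by
        intro c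
        rw [pow_succ', Real.mul_rpow (by positivity) (by positivity)]
      rw [e, e', e', mul_assoc, mul_assoc]
      exact ⟨h.1.trans (by gcongr; exact h'.1), le_trans (by gcongr; exact h'.2) h.2⟩
  refine ⟨2 ^ a + 2 ^ b, by positivity, R, hRpos, fun x y hx hy => ?_⟩
  have hx0 : 0 < x := hRpos.trans_le hx
  have hy0 : 0 < y := hRpos.trans_le hy
  have hνx := hν_pos x hx0
  have hνy := hν_pos y hy0
  have hxy : 0 < x / y := by positivity
  rcases le_total y x with h | h
  · obtain ⟨n, hn, hn'⟩ := exists_nat_pow_near ((one_le_div hy0).2 h) (one_lt_two)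
    have h1 : ν x ≤ ((2 : ℝ) ^ n) ^ (-a) * ν y :=
      (hν_mono _ _ (by positivity) ((le_div_iff₀ hy0).1 hn)).trans (hiter n y hy).1
    have h2 : ((2 : ℝ) ^ n) ^ (-a) ≤ 2 ^ a * (x / y) ^ (-a) := by
      have : (x / y) / 2 ≤ 2 ^ n := by rw [pow_succ] at hn'; linarith
      calc ((2 : ℝ) ^ n) ^ (-a) ≤ ((x / y) / 2) ^ (-a) :=
            Real.rpow_le_rpow_of_nonpos (by positivity) this (by linarith)
        _ = 2 ^ a * (x / y) ^ (-a) := by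
            rw [Real.div_rpow hxy.le (by norm_num), Real.rpow_neg (by norm_num : (0:ℝ) ≤ 2)]
            field_simp
    refine h1.trans ?_
    gcongr
    refine h2.trans ?_
    have : 0 < (x / y) ^ (-a) := by positivity
    have : 0 < (x / y) ^ (-b) := by positivity
    have : (0 : ℝ) < 2 ^ a := by positivity
    have : (0 : ℝ) < 2 ^ b := by positivity
    rw [add_mul]
    refine le_add_of_le_of_nonneg ?_ (by positivity)
    gcongr
    linarith
  · obtain ⟨n, hn, hn'⟩ := exists_nat_pow_near ((one_le_div hx0).2 h) (one_lt_two)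
    have h1 : ((2 : ℝ) ^ (n + 1)) ^ (-b) * ν x ≤ ν y :=
      (hiter (n + 1) x hx).2.trans (hν_mono _ _ hy0 ((div_lt_iff₀ hx0).1 hn').le)
    have h2 : (2 : ℝ) ^ (-b) * (x / y) ^ b ≤ ((2 : ℝ) ^ (n + 1)) ^ (-b) := by
      have : (2 : ℝ) ^ (n + 1) ≤ 2 * (y / x) := by rw [pow_succ']; gcongr
      refine le_trans (le_of_eq ?_)
        (Real.rpow_le_rpow_of_nonpos (by positivity) this (by linarith))
      rw [Real.mul_rpow (by norm_num) (by positivity), ← inv_div x y,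
        Real.inv_rpow hxy.le, Real.rpow_neg hxy.le, inv_inv]
    have h3 : ν x ≤ 2 ^ b * (x / y) ^ (-b) * ν y := by
      have h4 := (mul_le_mul_of_nonneg_right h2 hνx.le).trans h1
      rw [Real.rpow_neg (by norm_num)] at h4
      rw [Real.rpow_neg hxy.le]
      have : 0 < (x / y) ^ b := by positivity
      field_simp at h4 ⊢
      linarith
    refine h3.trans ?_
    gcongr
    · have : (0 : ℝ) < 2 ^ a := by positivity
      linarith
    · have : 0 < (x / y) ^ (-a) := by positivity
      linarith

lemma one_sub_cos_inner_le {d : ℕ} (ξ z : EuclideanSpace ℝ (Fin d)) :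
    1 - Real.cos ⟪ξ, z⟫ ≤ ‖ξ‖ ^ 2 * ‖z‖ ^ 2 / 2 := by
  have h1 := Real.one_sub_sq_div_two_le_cos (x := ⟪ξ, z⟫)
  have h2 : ⟪ξ, z⟫ ^ 2 ≤ ‖ξ‖ ^ 2 * ‖z‖ ^ 2 := by
    rw [← mul_pow]
    exact sq_le_sq.2 ((abs_real_inner_le_norm ξ z).trans (le_abs_self _))
  linarith

lemma one_sub_cos_inner_le_min {d : ℕ} (ξ z : EuclideanSpace ℝ (Fin d)) :
    1 - Real.cos ⟪ξ, z⟫ ≤ (2 + ‖ξ‖ ^ 2) * min (‖z‖ ^ 2) 1 := by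
  have h0 := sq_nonneg ‖ξ‖
  rcases min_choice (‖z‖ ^ 2) 1 with h | h <;> rw [h]
  · have := one_sub_cos_inner_le ξ z
    nlinarith [mul_nonneg h0 (sq_nonneg ‖z‖), sq_nonneg ‖z‖]
  · linarith [Real.neg_one_le_cos ⟪ξ, z⟫]

lemma integrable_one_sub_cos_mul {d : ℕ} (hd : 1 ≤ d) {ν : ℝ → ℝ}
    (hν_pos : ∀ r : ℝ, 0 < r → 0 < ν r)
    (hν_mono : ∀ r₁ r₂ : ℝ, 0 < r₁ → r₁ ≤ r₂ → ν r₂ ≤ ν r₁)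
    (hint : Integrable (fun z : EuclideanSpace ℝ (Fin d) => min (‖z‖ ^ 2) 1 * ν ‖z‖))
    (ξ : EuclideanSpace ℝ (Fin d)) :
    AEStronglyMeasurable (fun z : EuclideanSpace ℝ (Fin d) => (1 - Real.cos ⟪ξ, z⟫) * ν ‖z‖) ∧
    Integrable (fun z : EuclideanSpace ℝ (Fin d) => (1 - Real.cos ⟪ξ, z⟫) * ν ‖z‖) ∧
    ∀ z : EuclideanSpace ℝ (Fin d), ‖(1 - Real.cos ⟪ξ, z⟫) * ν ‖z‖‖ ≤
      (2 + ‖ξ‖ ^ 2) * (min (‖z‖ ^ 2) 1 * ν ‖z‖) := by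
  have hm : AEStronglyMeasurable
      (fun z : EuclideanSpace ℝ (Fin d) => (1 - Real.cos ⟪ξ, z⟫) * ν ‖z‖) := by
    refine AEStronglyMeasurable.mul (Continuous.aestronglyMeasurable (by fun_prop)) ?_
    simpa using aestronglyMeasurable_comp_mul_norm hd hν_mono one_pos
  have hb : ∀ z : EuclideanSpace ℝ (Fin d), ‖(1 - Real.cos ⟪ξ, z⟫) * ν ‖z‖‖ ≤
      (2 + ‖ξ‖ ^ 2) * (min (‖z‖ ^ 2) 1 * ν ‖z‖) := by
    intro z
    rcases eq_or_ne z 0 with rfl | hz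
    · simp
    · have := hν_pos _ (norm_pos_iff.2 hz)
      have h1 : 0 ≤ 1 - Real.cos ⟪ξ, z⟫ := sub_nonneg.2 (Real.cos_le_one _)
      rw [Real.norm_of_nonneg (by positivity), ← mul_assoc]
      gcongr
      exact one_sub_cos_inner_le_min ξ z
  exact ⟨hm, (hint.const_mul _).mono' hm (Eventually.of_forall hb), hb⟩

lemma continuous_ψ {d : ℕ} (hd : 1 ≤ d) {ν : ℝ → ℝ}
    (hν_pos : ∀ r : ℝ, 0 < r → 0 < ν r)
    (hν_mono : ∀ r₁ r₂ : ℝ, 0 < r₁ → r₁ ≤ r₂ → ν r₂ ≤ ν r₁)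
    (hint : Integrable (fun z : EuclideanSpace ℝ (Fin d) => min (‖z‖ ^ 2) 1 * ν ‖z‖)) :
    Continuous (ψ d ν) := by
  refine continuous_iff_continuousAt.2 fun ξ₀ => ?_
  have h := integrable_one_sub_cos_mul hd hν_pos hν_mono hint
  refine continuousAt_of_dominated
    (bound := fun z => (2 + (‖ξ₀‖ + 1) ^ 2) * (min (‖z‖ ^ 2) 1 * ν ‖z‖))
    (Eventually.of_forall fun ξ => (h ξ).1) ?_ (hint.const_mul _) ?_
  · have hlt : ∀ᶠ ξ in nhds ξ₀, ‖ξ‖ < ‖ξ₀‖ + 1 :=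
      continuous_norm.continuousAt.eventually_lt_const (lt_add_one _)
    filter_upwards [hlt] with ξ hξ
    refine Eventually.of_forall fun z => ((h ξ).2.2 z).trans ?_
    have : 0 ≤ min (‖z‖ ^ 2) 1 * ν ‖z‖ := by
      rcases eq_or_ne z 0 with rfl | hz
      · simp
      · have := hν_pos _ (norm_pos_iff.2 hz)
        positivity
    gcongr
  · exact Eventually.of_forall fun z => Continuous.continuousAt (by fun_prop)

lemma ψ_eq_of_norm_eq {d : ℕ} (ν : ℝ → ℝ) {ξ η : EuclideanSpace ℝ (Fin d)} (h : ‖ξ‖ = ‖η‖) :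
    ψ d ν ξ = ψ d ν η := by
  set T := (ℝ ∙ (ξ - η))ᗮ.reflection with hT
  have hTξ : T ξ = η := Submodule.reflection_sub h
  symm
  unfold ψ
  rw [← T.measurePreserving.integral_comp T.toHomeomorph.measurableEmbedding]
  refine integral_congr_ae (Eventually.of_forall fun z => ?_)
  simp only [← hTξ, LinearIsometryEquiv.inner_map_map, LinearIsometryEquiv.norm_map]

lemma ψinv_spec {d : ℕ} {ν : ℝ → ℝ} (hcont : Continuous (ψ d ν))
    {e : EuclideanSpace ℝ (Fin d)} (he : ‖e‖ = 1) (h1 : ψ d ν e = 1) {u : ℝ} (hu0 : 0 < u)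
    (hu1 : u < 1) :
    0 < ψinv d ν u ∧ ψ d ν (ψinv d ν u • e) = u ∧
      ∀ z : EuclideanSpace ℝ (Fin d), ‖z‖ ≤ ψinv d ν u → ψ d ν z ≤ u := by
  have hrad : ∀ z, ψ d ν z = ψ d ν (‖z‖ • e) := fun z =>
    ψ_eq_of_norm_eq ν (by rw [norm_smul, he]; simp)
  have hφ : Continuous fun r : ℝ => ψ d ν (r • e) := by fun_prop
  have hψ0 : ψ d ν 0 = 0 := by simp [ψ]
  have hbdd : ∀ r, BddAbove {y : ℝ | ∃ z : EuclideanSpace ℝ (Fin d), ‖z‖ ≤ r ∧ ψ d ν z = y} := by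
    intro r
    refine ((isCompact_closedBall (0 : EuclideanSpace ℝ (Fin d)) r).image hcont).bddAbove.mono ?_
    rintro y ⟨z, hz, rfl⟩
    exact ⟨z, mem_closedBall_zero_iff.2 hz, rfl⟩
  set S : Set ℝ := {r : ℝ | 0 ≤ r ∧ ψstar d ν r = u} with hS
  have hψinv : ψinv d ν u = sSup S := rfl
  have hSle : ∀ r ∈ S, ∀ z : EuclideanSpace ℝ (Fin d), ‖z‖ ≤ r → ψ d ν z ≤ u := by
    intro r hr z hz
    rw [← hr.2]
    exact le_csSup (hbdd r) ⟨z, hz, rfl⟩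
  have hS1 : ∀ r ∈ S, r ≤ 1 := by
    intro r hr
    by_contra! hlt
    have := hSle r hr e (he.le.trans hlt.le)
    linarith
  have hSbdd : BddAbove S := ⟨1, hS1⟩
  have hfirst : ∀ a, 0 ≤ a → a ≤ 1 →
      (∀ z : EuclideanSpace ℝ (Fin d), ‖z‖ ≤ a → ψ d ν z ≤ u) →
      ∃ r ∈ S, a ≤ r ∧ ψ d ν (r • e) = u := by
    intro a ha0 ha1 ha
    have haφ : ψ d ν (a • e) ≤ u := ha _ (by rw [norm_smul, he, Real.norm_of_nonneg ha0, mul_one])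
    have h1φ : ψ d ν ((1 : ℝ) • e) = 1 := by rw [one_smul, h1]
    set T : Set ℝ := Set.Ici a ∩ (fun r : ℝ => ψ d ν (r • e)) ⁻¹' {u} with hT
    have hTc : IsClosed T := isClosed_Ici.inter (isClosed_singleton.preimage hφ)
    have hTb : BddBelow T := ⟨a, fun r hr => hr.1⟩
    have hTn : T.Nonempty := by
      obtain ⟨r, hr, hr'⟩ := intermediate_value_Icc ha1 hφ.continuousOn
        (show u ∈ Set.Icc _ _ from ⟨haφ, by rw [h1φ]; exact hu1.le⟩)
      exact ⟨r, hr.1, hr'⟩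
    have hmem := hTc.csInf_mem hTn hTb
    have hr0 : 0 ≤ sInf T := ha0.trans hmem.1
    have hval : ψ d ν (sInf T • e) = u := hmem.2
    refine ⟨sInf T, ⟨hr0, ?_⟩, hmem.1, hval⟩
    refine IsGreatest.csSup_eq ⟨⟨sInf T • e, ?_, hval⟩, ?_⟩
    · rw [norm_smul, he, Real.norm_of_nonneg hr0, mul_one]
    · rintro y ⟨z, hz, rfl⟩
      by_contra! hlt
      have haz : a ≤ ‖z‖ := by
        by_contra! h
        exact absurd (ha z h.le) (not_le.2 hlt)
      rw [hrad] at hlt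
      obtain ⟨r, hr, hr'⟩ := intermediate_value_Icc haz hφ.continuousOn
        (show u ∈ Set.Icc _ _ from ⟨haφ, hlt.le⟩)
      have h2 : sInf T ≤ r := csInf_le hTb ⟨hr.1, hr'⟩
      have h3 : r = ‖z‖ := le_antisymm hr.2 (hz.trans h2)
      rw [h3] at hr'
      exact hlt.ne' hr'
  obtain ⟨r₀, hr₀S, -, hr₀⟩ := hfirst 0 le_rfl zero_le_one (by
    intro z hz
    rw [norm_le_zero_iff.1 hz, hψ0]; exact hu0.le)
  have hr₀pos : 0 < r₀ := by
    refine lt_of_le_of_ne hr₀S.1 ?_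
    rintro rfl
    rw [zero_smul, hψ0] at hr₀
    exact hu0.ne hr₀
  have hRpos : 0 < sSup S := hr₀pos.trans_le (le_csSup hSbdd hr₀S)
  have hRle : ∀ z : EuclideanSpace ℝ (Fin d), ‖z‖ ≤ sSup S → ψ d ν z ≤ u := by
    have hsub : Metric.ball (0 : EuclideanSpace ℝ (Fin d)) (sSup S) ⊆ {z | ψ d ν z ≤ u} := by
      intro z hz
      obtain ⟨r, hr, hzr⟩ := exists_lt_of_lt_csSup ⟨r₀, hr₀S⟩ (mem_ball_zero_iff.1 hz)
      exact hSle r hr z hzr.le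
    have hcl := closure_minimal hsub (isClosed_le hcont continuous_const)
    rw [closure_ball _ hRpos.ne'] at hcl
    exact fun z hz => hcl (mem_closedBall_zero_iff.2 hz)
  obtain ⟨r, hrS, hRr, hr⟩ := hfirst (sSup S) hRpos.le (csSup_le ⟨r₀, hr₀S⟩ hS1) hRle
  have hrR : r = sSup S := le_antisymm (le_csSup hSbdd hrS) hRr
  rw [hψinv]
  exact ⟨hRpos, hrR ▸ hr, hRle⟩

lemma tendsto_ratio_mul {d : ℕ} {ν : ℝ → ℝ} {α : ℝ}
    (hA2 : ∀ lam : ℝ, 0 < lam →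
      Tendsto (fun r : ℝ => ν (lam * r) / ν r) atTop (nhds (lam ^ (-(d:ℝ) - α))))
    {w : EuclideanSpace ℝ (Fin d)} (hw : w ≠ 0) :
    Tendsto (fun r : ℝ => ν (r * ‖w‖) / ν r) atTop (nhds (‖w‖ ^ (-(d:ℝ) - α))) := by
  simpa only [mul_comm] using hA2 ‖w‖ (norm_pos_iff.2 hw)

/-- The contribution of the small jumps to the characteristic exponent is negligible at the
origin. -/
lemma tendsto_small_jumps_div {d : ℕ} (hd : 1 ≤ d) {ν : ℝ → ℝ}
    (hν_pos : ∀ r : ℝ, 0 < r → 0 < ν r)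
    (hint : Integrable (fun z : EuclideanSpace ℝ (Fin d) => min (‖z‖ ^ 2) 1 * ν ‖z‖))
    {a b : ℝ} (hab : a < b) (hb : b < d + 2) {C R : ℝ} (hC : 0 < C) (hR : 0 < R)
    (hpot : ∀ x y : ℝ, R ≤ x → R ≤ y → ν x ≤ C * ((x / y) ^ (-a) + (x / y) ^ (-b)) * ν y)
    {e : EuclideanSpace ℝ (Fin d)} (he : ‖e‖ = 1) :
    Tendsto (fun r : ℝ => (∫ z in {z : EuclideanSpace ℝ (Fin d) | R ≤ ‖z‖}ᶜ,
      (1 - Real.cos ⟪r⁻¹ • e, z⟫) * ν ‖z‖) / (r ^ d * ν r)) atTop (nhds 0) := by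
  have : Nonempty (Fin d) := ⟨⟨0, hd⟩⟩
  have hne : ∀ᵐ w : EuclideanSpace ℝ (Fin d), w ≠ 0 := by rw [ae_iff]; simp
  have hcos : ∀ ξ w : EuclideanSpace ℝ (Fin d), 0 ≤ 1 - Real.cos ⟪ξ, w⟫ :=
    fun ξ w => sub_nonneg.2 (Real.cos_le_one _)
  set S : Set (EuclideanSpace ℝ (Fin d)) := {z | R ≤ ‖z‖} with hSdef
  have hS : MeasurableSet S := measurableSet_le measurable_const (by fun_prop)
  set E : ℝ → ℝ := fun r => ∫ z in Sᶜ, (1 - Real.cos ⟪r⁻¹ • e, z⟫) * ν ‖z‖ with hEdef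
  set M : ℝ := ∫ z in Sᶜ, (1 + R ^ 2) * (min (‖z‖ ^ 2) 1 * ν ‖z‖) with hM
  have hνR := hν_pos R hR
  have hlim : Tendsto (fun r : ℝ => M * (2 * C * R ^ (-b)) / ν R * r ^ (-(d + 2 - b)))
      atTop (nhds 0) := by
    simpa using (tendsto_rpow_neg_atTop (show 0 < d + 2 - b by linarith)).const_mul
      (M * (2 * C * R ^ (-b)) / ν R)
  refine squeeze_zero_norm' ?_ hlim
  filter_upwards [eventually_ge_atTop R] with r hr
  have hr0 : 0 < r := hR.trans_le hr
  have hνr := hν_pos r hr0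
  have hEM : ‖E r‖ ≤ M * (r ^ 2)⁻¹ := by
    rw [hM, ← integral_mul_const]
    refine norm_integral_le_of_norm_le ((hint.const_mul _).mul_const _).integrableOn ?_
    filter_upwards [ae_restrict_mem hS.compl, ae_restrict_of_ae hne] with z hz hz0
    have hz1 : ‖z‖ < R := not_le.1 hz
    have hz0' := norm_pos_iff.2 hz0
    have hνz := hν_pos _ hz0'
    rw [Real.norm_of_nonneg (mul_nonneg (hcos _ z) hνz.le)]
    have h1 := one_sub_cos_inner_le (r⁻¹ • e) z
    rw [norm_smul, he, mul_one, norm_inv, Real.norm_of_nonneg hr0.le, inv_pow] at h1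
    have h2 : ‖z‖ ^ 2 / 2 ≤ (1 + R ^ 2) * min (‖z‖ ^ 2) 1 := by
      have : ‖z‖ ^ 2 ≤ R ^ 2 := by gcongr
      rcases min_choice (‖z‖ ^ 2) 1 with h | h <;> rw [h] <;>
        nlinarith [sq_nonneg R, sq_nonneg ‖z‖, mul_nonneg (sq_nonneg R) (sq_nonneg ‖z‖)]
    calc (1 - Real.cos ⟪r⁻¹ • e, z⟫) * ν ‖z‖ ≤ ((r ^ 2)⁻¹ * ‖z‖ ^ 2 / 2) * ν ‖z‖ := by gcongr
      _ = (r ^ 2)⁻¹ * (‖z‖ ^ 2 / 2) * ν ‖z‖ := by ring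
      _ ≤ (r ^ 2)⁻¹ * ((1 + R ^ 2) * min (‖z‖ ^ 2) 1) * ν ‖z‖ := by gcongr
      _ = _ := by ring
  change ‖E r / (r ^ d * ν r)‖ ≤ _
  rw [norm_div, Real.norm_of_nonneg (show 0 ≤ r ^ d * ν r by positivity)]
  have hN := norm_nonneg (E r)
  generalize ‖E r‖ = N at hN hEM ⊢
  clear_value M E S
  have hνinv : ν R ≤ 2 * C * R ^ (-b) * r ^ b * ν r := by
    refine (hpot R r le_rfl hr).trans ?_
    have h1 : R / r ≤ 1 := (div_le_one hr0).2 hr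
    have h2 : (R / r) ^ (-a) ≤ (R / r) ^ (-b) :=
      Real.rpow_le_rpow_of_exponent_ge (by positivity) h1 (by linarith)
    have h3 : (R / r) ^ (-b) = R ^ (-b) * r ^ b := by
      rw [Real.div_rpow hR.le hr0.le, Real.rpow_neg hr0.le]; field_simp
    calc C * ((R / r) ^ (-a) + (R / r) ^ (-b)) * ν r
        ≤ C * ((R / r) ^ (-b) + (R / r) ^ (-b)) * ν r := by gcongr
      _ = _ := by rw [h3]; ring
  have hM0 : 0 ≤ M :=
    nonneg_of_mul_nonneg_left (hN.trans hEM) (by positivity)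
  have hpow : r ^ (-(d + 2 - b)) = r ^ b * ((r ^ 2)⁻¹ * (r ^ d)⁻¹) := by
    rw [← mul_inv, ← pow_add, ← Real.rpow_natCast, ← Real.rpow_neg hr0.le,
      ← Real.rpow_add hr0]
    congr 1; push_cast; ring
  rw [hpow]
  calc N / (r ^ d * ν r) ≤ M * (r ^ 2)⁻¹ / (r ^ d * ν r) := by gcongr
    _ = M * (r ^ 2)⁻¹ * (r ^ d)⁻¹ / ν R * (ν R / ν r) := by field_simp
    _ ≤ M * (r ^ 2)⁻¹ * (r ^ d)⁻¹ / ν R * (2 * C * R ^ (-b) * r ^ b) := by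
        gcongr
        rw [div_le_iff₀ hνr]
        exact hνinv
    _ = _ := by ring

/-- Tauberian-type asymptotics of the characteristic exponent at the origin. -/
lemma tendsto_ψ_div {d : ℕ} (hd : 1 ≤ d) {ν : ℝ → ℝ}
    (hν_pos : ∀ r : ℝ, 0 < r → 0 < ν r)
    (hν_mono : ∀ r₁ r₂ : ℝ, 0 < r₁ → r₁ ≤ r₂ → ν r₂ ≤ ν r₁)
    (hint : Integrable (fun z : EuclideanSpace ℝ (Fin d) => min (‖z‖ ^ 2) 1 * ν ‖z‖))
    {α : ℝ} (hα : 0 < α) {a b : ℝ} (ha : d < a) (haα : a < d + α)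
    (hbα : d + α < b) (hb : b < d + 2)
    (hA2 : ∀ lam : ℝ, 0 < lam →
      Tendsto (fun r : ℝ => ν (lam * r) / ν r) atTop (nhds (lam ^ (-(d:ℝ) - α))))
    {C R : ℝ} (hC : 0 < C) (hR : 0 < R)
    (hpot : ∀ x y : ℝ, R ≤ x → R ≤ y → ν x ≤ C * ((x / y) ^ (-a) + (x / y) ^ (-b)) * ν y)
    {e : EuclideanSpace ℝ (Fin d)} (he : ‖e‖ = 1) :
    Tendsto (fun r : ℝ => ψ d ν (r⁻¹ • e) / (r ^ d * ν r)) atTop (nhds (Aconst d α)⁻¹) := by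
  have : Nonempty (Fin d) := ⟨⟨0, hd⟩⟩
  have hne : ∀ᵐ w : EuclideanSpace ℝ (Fin d), w ≠ 0 := by rw [ae_iff]; simp
  have hcos : ∀ ξ w : EuclideanSpace ℝ (Fin d), 0 ≤ 1 - Real.cos ⟪ξ, w⟫ :=
    fun ξ w => sub_nonneg.2 (Real.cos_le_one _)
  let F : ℝ → EuclideanSpace ℝ (Fin d) → ℝ := fun r => {w | R ≤ r * ‖w‖}.indicator
    (fun w => (1 - Real.cos ⟪e, w⟫) * (ν (r * ‖w‖) / ν r))
  have hSm : ∀ r : ℝ, MeasurableSet {w : EuclideanSpace ℝ (Fin d) | R ≤ r * ‖w‖} := fun r =>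
    measurableSet_le measurable_const (by fun_prop)
  have hF : Tendsto (fun r => ∫ w, F r w) atTop (nhds (Aconst d α)⁻¹) := by
    rw [← integral_one_sub_cos_mul_rpow hd hα (by linarith) he]
    refine tendsto_integral_filter_of_dominated_convergence
      (fun w => (3 * C) * (min (‖w‖ ^ 2) 1 * ‖w‖ ^ (-a) + min (‖w‖ ^ 2) 1 * ‖w‖ ^ (-b)))
      ?_ ?_ ?_ ?_
    · filter_upwards [eventually_gt_atTop 0] with r hr
      refine AEStronglyMeasurable.indicator ?_ (hSm r)
      refine AEStronglyMeasurable.mul (Continuous.aestronglyMeasurable (by fun_prop)) ?_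
      simp only [div_eq_mul_inv]
      exact (aestronglyMeasurable_comp_mul_norm hd hν_mono hr).mul_const _
    · filter_upwards [eventually_ge_atTop R] with r hr
      have hr0 : 0 < r := hR.trans_le hr
      have hνr := hν_pos r hr0
      refine Eventually.of_forall fun w => ?_
      by_cases hw : R ≤ r * ‖w‖
      · have hw0 : 0 < r * ‖w‖ := hR.trans_le hw
        have hw1 : 0 < ‖w‖ := pos_of_mul_pos_right hw0 hr0.le
        have hνw := hν_pos _ hw0
        have h1 : ν (r * ‖w‖) / ν r ≤ C * (‖w‖ ^ (-a) + ‖w‖ ^ (-b)) := by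
          rw [div_le_iff₀ hνr]
          have := hpot (r * ‖w‖) r hw hr
          rwa [mul_div_cancel_left₀ _ hr0.ne'] at this
        have h2 := one_sub_cos_inner_le_min e w
        rw [he] at h2
        simp only [F]
        rw [Set.indicator_of_mem (by exact hw),
          Real.norm_of_nonneg (mul_nonneg (hcos e w) (by positivity))]
        calc (1 - Real.cos ⟪e, w⟫) * (ν (r * ‖w‖) / ν r)
            ≤ ((2 + 1 ^ 2) * min (‖w‖ ^ 2) 1) * (C * (‖w‖ ^ (-a) + ‖w‖ ^ (-b))) := by
              gcongr
          _ = _ := by ring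
      · simp only [F]
        rw [Set.indicator_of_notMem (by exact hw), norm_zero]
        positivity
    · exact ((integrable_min_sq_mul_rpow_norm hd ha (by linarith)).add
        (integrable_min_sq_mul_rpow_norm hd (by linarith) hb)).const_mul _
    · filter_upwards [hne] with w hw
      have hw' : 0 < ‖w‖ := norm_pos_iff.2 hw
      refine ((tendsto_ratio_mul hA2 hw).const_mul (1 - Real.cos ⟪e, w⟫)).congr' ?_
      filter_upwards [eventually_ge_atTop (R / ‖w‖)] with r hr
      simp only [F]
      rw [Set.indicator_of_mem (show w ∈ {w | R ≤ r * ‖w‖} from (div_le_iff₀ hw').1 hr)]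
  set S : Set (EuclideanSpace ℝ (Fin d)) := {z | R ≤ ‖z‖} with hSdef
  have hS : MeasurableSet S := measurableSet_le measurable_const (by fun_prop)
  let E : ℝ → ℝ := fun r => ∫ z in Sᶜ, (1 - Real.cos ⟪r⁻¹ • e, z⟫) * ν ‖z‖
  have hdecomp : ∀ r, 0 < r →
      ψ d ν (r⁻¹ • e) / (r ^ d * ν r) = (∫ w, F r w) + E r / (r ^ d * ν r) := by
    intro r hr
    have hνr := hν_pos r hr
    have hsplit := integral_add_compl hS
      (integrable_one_sub_cos_mul hd hν_pos hν_mono hint (r⁻¹ • e)).2.1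
    have hscale : ∫ z in S, (1 - Real.cos ⟪r⁻¹ • e, z⟫) * ν ‖z‖ =
        r ^ d * ν r * ∫ w, F r w := by
      have h := Measure.integral_comp_smul_of_nonneg (volume : Measure (EuclideanSpace ℝ (Fin d)))
        (S.indicator fun z => (1 - Real.cos ⟪r⁻¹ • e, z⟫) * ν ‖z‖) r (hR := hr.le)
      rw [integral_indicator hS, finrank_euclideanSpace, Fintype.card_fin, smul_eq_mul] at h
      have h' : ∀ w, S.indicator (fun z => (1 - Real.cos ⟪r⁻¹ • e, z⟫) * ν ‖z‖) (r • w) =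
          ν r * F r w := by
        intro w
        have hn : ‖r • w‖ = r * ‖w‖ := by rw [norm_smul, Real.norm_of_nonneg hr.le]
        have hi : ⟪r⁻¹ • e, r • w⟫ = ⟪e, w⟫ := by
          rw [real_inner_smul_left, real_inner_smul_right]; field_simp
        by_cases hw : R ≤ r * ‖w‖
        · simp only [F]
          rw [Set.indicator_of_mem (show w ∈ {w | R ≤ r * ‖w‖} from hw),
            Set.indicator_of_mem (show r • w ∈ S from hw.trans_eq hn.symm), hn, hi]
          field_simp
        · simp only [F]
          rw [Set.indicator_of_notMem (show w ∉ {w | R ≤ r * ‖w‖} from hw),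
            Set.indicator_of_notMem (show r • w ∉ S from fun h => hw (h.trans_eq hn)), mul_zero]
      simp only [h'] at h
      rw [integral_const_mul] at h
      rw [mul_assoc, h]
      field_simp
    change _ + E r = ψ d ν (r⁻¹ • e) at hsplit
    rw [← hsplit, hscale]
    field_simp
  have hE : Tendsto (fun r => E r / (r ^ d * ν r)) atTop (nhds 0) :=
    tendsto_small_jumps_div hd hν_pos hint (haα.trans hbα) hb hC hR hpot he
  have := hF.add hE
  rw [add_zero] at this
  refine this.congr' ?_
  filter_upwards [eventually_gt_atTop 0] with r hr
  exact (hdecomp r hr).symm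

/-- The generalized inverse `ψ⁻¹(1/s)` tends to zero as `s → ∞`, with the normalization
constant of the rescaled Lévy density converging to the stable constant. -/
lemma tendsto_ψinv_scaling {d : ℕ} {ν : ℝ → ℝ} {α : ℝ} (hν_pos : ∀ r : ℝ, 0 < r → 0 < ν r)
    (hcont : Continuous (ψ d ν)) {e : EuclideanSpace ℝ (Fin d)} (he : ‖e‖ = 1)
    (h1 : ψ d ν e = 1) (hA : 0 < Aconst d α)
    (hasymp : Tendsto (fun r : ℝ => ψ d ν (r⁻¹ • e) / (r ^ d * ν r)) atTop
      (nhds (Aconst d α)⁻¹)) :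
    (∀ᶠ s in atTop, 0 < ψinv d ν (1 / s)) ∧
    Tendsto (fun s => (ψinv d ν (1 / s))⁻¹) atTop atTop ∧
    Tendsto (fun s => s / ψinv d ν (1 / s) ^ d * ν (ψinv d ν (1 / s))⁻¹) atTop
      (nhds (Aconst d α)) := by
  have hspec : ∀ s : ℝ, 1 < s → 0 < ψinv d ν (1 / s) ∧
      ψ d ν (ψinv d ν (1 / s) • e) = 1 / s ∧
      ∀ z : EuclideanSpace ℝ (Fin d), ‖z‖ ≤ ψinv d ν (1 / s) → ψ d ν z ≤ 1 / s := fun s hs =>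
    ψinv_spec hcont he h1 (by positivity) ((div_lt_one (one_pos.trans hs)).2 hs)
  have hpos : ∀ᶠ s in atTop, 0 < ψinv d ν (1 / s) := by
    filter_upwards [eventually_gt_atTop 1] with s hs using (hspec s hs).1
  have hinf : Tendsto (fun s => (ψinv d ν (1 / s))⁻¹) atTop atTop := by
    refine tendsto_atTop.2 fun B => ?_
    obtain ⟨r, hr, hrB, hr0⟩ := ((hasymp.eventually_const_lt (inv_pos.2 hA)).and
      ((eventually_ge_atTop B).and (eventually_gt_atTop 0))).exists
    have hψ : 0 < ψ d ν (r⁻¹ • e) := by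
      have := hν_pos r hr0
      exact (div_pos_iff_of_pos_right (by positivity)).1 hr
    filter_upwards [eventually_gt_atTop 1, eventually_gt_atTop (ψ d ν (r⁻¹ • e))⁻¹] with s hs hs'
    obtain ⟨hp, -, hle⟩ := hspec s hs
    by_contra! hlt
    have hle' : r⁻¹ ≤ ψinv d ν (1 / s) := inv_le_of_inv_le₀ hp (hlt.le.trans hrB)
    have := hle (r⁻¹ • e) (by
      rw [norm_smul, he, mul_one, Real.norm_of_nonneg (by positivity)]; exact hle')
    rw [one_div] at this
    exact absurd (inv_lt_of_inv_lt₀ hψ hs') (not_lt.2 this)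
  refine ⟨hpos, hinf, ?_⟩
  have h := (hasymp.comp hinf).inv₀ (inv_pos.2 hA).ne'
  rw [inv_inv] at h
  refine h.congr' ?_
  filter_upwards [eventually_gt_atTop 1] with s hs
  obtain ⟨hp, heq, -⟩ := hspec s hs
  simp only [Function.comp_apply, inv_inv, heq]
  have hs0 : 0 < s := one_pos.trans hs
  rw [inv_pow]
  generalize ν (ψinv d ν (1 / s))⁻¹ = N
  generalize ψinv d ν (1 / s) = P at hp
  field_simp

lemma integrableOn_comp_mul_norm {d : ℕ} (hd : 1 ≤ d) {ν : ℝ → ℝ}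
    (hν_pos : ∀ r : ℝ, 0 < r → 0 < ν r)
    (hν_mono : ∀ r₁ r₂ : ℝ, 0 < r₁ → r₁ ≤ r₂ → ν r₂ ≤ ν r₁)
    (hint : Integrable (fun z : EuclideanSpace ℝ (Fin d) => min (‖z‖ ^ 2) 1 * ν ‖z‖))
    {c ε : ℝ} (hc : 0 < c) (hε : 0 < ε) :
    IntegrableOn (fun z : EuclideanSpace ℝ (Fin d) => ν (c * ‖z‖)) {z | ε ≤ ‖z‖} := by
  have h := (hint.comp_smul hc.ne').const_mul (min ((c * ε) ^ 2) 1)⁻¹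
  refine h.integrableOn.mono' (aestronglyMeasurable_comp_mul_norm hd hν_mono hc).restrict ?_
  have hS : MeasurableSet {z : EuclideanSpace ℝ (Fin d) | ε ≤ ‖z‖} :=
    measurableSet_le measurable_const (by fun_prop)
  filter_upwards [ae_restrict_mem hS] with z hz
  have hz' : ε ≤ ‖z‖ := hz
  have hz0 : 0 < ‖z‖ := hε.trans_le hz'
  have hν := hν_pos (c * ‖z‖) (by positivity)
  rw [norm_smul, Real.norm_of_nonneg hc.le, Real.norm_of_nonneg hν.le, ← mul_assoc]
  refine le_mul_of_one_le_left hν.le ?_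
  rw [← div_eq_inv_mul, one_le_div (by positivity)]
  gcongr

lemma integrableOn_rpow_norm {d : ℕ} (hd : 1 ≤ d) {p ε : ℝ} (hp : d < p) (hp2 : p < d + 2)
    (hε : 0 < ε) :
    IntegrableOn (fun z : EuclideanSpace ℝ (Fin d) => ‖z‖ ^ (-p)) {z | ε ≤ ‖z‖} := by
  have hp0 : 0 ≤ p := (Nat.cast_nonneg d).trans hp.le
  simpa using integrableOn_comp_mul_norm hd (ν := fun r => r ^ (-p))
    (fun r hr => by positivity)
    (fun r₁ r₂ h₁ h₂ => Real.rpow_le_rpow_of_nonpos h₁ h₂ (neg_nonpos.2 hp0))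
    (integrable_min_sq_mul_rpow_norm hd hp hp2) one_pos hε

theorem statement9
    (d : ℕ) (hd : 1 ≤ d) (ν : ℝ → ℝ)
    (hν_pos : ∀ r : ℝ, 0 < r → 0 < ν r)
    (hν_mono : ∀ r₁ r₂ : ℝ, 0 < r₁ → r₁ ≤ r₂ → ν r₂ ≤ ν r₁)
    (hint : Integrable (fun z : EuclideanSpace ℝ (Fin d) => min (‖z‖ ^ 2) 1 * ν ‖z‖))
    (hninf : ¬ Integrable (fun z : EuclideanSpace ℝ (Fin d) => ν ‖z‖))
    (α : ℝ) (hα : α ∈ Set.Ioo (0:ℝ) 2)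
    (hA2 : ∀ lam : ℝ, 0 < lam →
      Tendsto (fun r : ℝ => ν (lam * r) / ν r) atTop (nhds (lam ^ (-(d:ℝ) - α))))
    (hnorm : ∀ ξ : EuclideanSpace ℝ (Fin d), ‖ξ‖ = 1 → ψ d ν ξ = 1)
    (Γ : Set (EuclideanSpace ℝ (Fin d))) (hΓ : IsOpen Γ)
    (x : EuclideanSpace ℝ (Fin d)) (hx : x ∈ Γ)
:
    (∀ s : ℝ, 1 ≤ s → IntegrableOn (fun y => νs d ν s (y - x)) Γᶜ) ∧
    IntegrableOn (fun y : EuclideanSpace ℝ (Fin d) =>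
      Aconst d α * ‖y - x‖ ^ (-(d:ℝ) - α)) Γᶜ ∧
    Tendsto (fun s : ℝ => ∫ y in Γᶜ, νs d ν s (y - x)) atTop
      (nhds (∫ y in Γᶜ, Aconst d α * ‖y - x‖ ^ (-(d:ℝ) - α))) := by
  obtain ⟨hα0, hα2⟩ := hα
  have : Nonempty (Fin d) := ⟨⟨0, hd⟩⟩
  obtain ⟨e, he⟩ : ∃ e : EuclideanSpace ℝ (Fin d), ‖e‖ = 1 :=
    ⟨EuclideanSpace.single ⟨0, hd⟩ 1, by simp⟩
  obtain ⟨ε, hε, hball⟩ := Metric.isOpen_iff.1 hΓ x hx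
  have hsub : ∀ y ∈ Γᶜ, ε ≤ ‖y - x‖ := by
    intro y hy
    by_contra! h
    exact hy (hball (mem_ball_iff_norm.2 h))
  have htrans : ∀ g : EuclideanSpace ℝ (Fin d) → ℝ, IntegrableOn g {z | ε ≤ ‖z‖} →
      IntegrableOn (fun y => g (y - x)) Γᶜ := by
    intro g hg
    have hS : MeasurableSet {z : EuclideanSpace ℝ (Fin d) | ε ≤ ‖z‖} :=
      measurableSet_le measurable_const (by fun_prop)
    have h := ((integrable_indicator_iff hS).2 hg).comp_sub_right x
    refine h.integrableOn.congr_fun (fun y hy => ?_) hΓ.measurableSet.compl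
    exact Set.indicator_of_mem (show y - x ∈ {z | ε ≤ ‖z‖} from hsub y hy) g
  have hνs : ∀ s : ℝ, 0 < ψinv d ν (1 / s) →
      IntegrableOn (fun y => νs d ν s (y - x)) Γᶜ := by
    intro s hs
    refine htrans (νs d ν s) ?_
    have h := integrableOn_comp_mul_norm hd hν_pos hν_mono hint (inv_pos.2 hs) hε
    unfold νs
    simp only [div_eq_inv_mul _ (ψinv d ν (1 / s))]
    exact h.const_mul _
  have hpow : ∀ p : ℝ, d < p → p < d + 2 →
      IntegrableOn (fun y : EuclideanSpace ℝ (Fin d) => ‖y - x‖ ^ (-p)) Γᶜ := fun p hp hp2 =>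
    htrans (fun z => ‖z‖ ^ (-p)) (integrableOn_rpow_norm hd hp hp2 hε)
  refine ⟨fun s _ => ?_, ?_, ?_⟩
  · have h0 : 0 ≤ ψinv d ν (1 / s) := Real.sSup_nonneg fun r hr => hr.1
    rcases h0.eq_or_lt with h | h
    · have hz : (fun y => νs d ν s (y - x)) = fun _ => 0 := by
        ext y
        rw [νs, ← h, zero_pow (by omega), div_zero, zero_mul]
      rw [hz]
      exact integrableOn_zero
    · exact hνs s h
  · have h := hpow (d + α) (by linarith) (by linarith)
    rw [neg_add'] at h
    exact h.const_mul _
  set δ := min α (2 - α) / 2 with hδ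
  have hm : 0 < min α (2 - α) := lt_min hα0 (by linarith)
  have hm1 : min α (2 - α) ≤ α := min_le_left _ _
  have hm2 : min α (2 - α) ≤ 2 - α := min_le_right _ _
  have had : (d : ℝ) < d + α - δ := by linarith
  have hbd : d + α + δ < (d : ℝ) + 2 := by linarith
  have hd0 : (0 : ℝ) ≤ d := Nat.cast_nonneg d
  obtain ⟨C, hC, R, hR, hpot⟩ := exists_potter_bound hν_pos hν_mono
    (a := d + α - δ) (b := d + α + δ) (γ := d + α) (by linarith) (by linarith) (by linarith)
    (by simpa only [neg_add'] using hA2 2 two_pos)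
  have hA : 0 < Aconst d α := by
    have := Real.Gamma_pos_of_pos (show 0 < ((d : ℝ) + α) / 2 by positivity)
    have := Real.Gamma_pos_of_pos (show 0 < 1 - α / 2 by linarith)
    unfold Aconst
    positivity
  have hasymp := tendsto_ψ_div hd hν_pos hν_mono hint hα0 had (by linarith) (by linarith) hbd
    hA2 hC hR hpot he
  obtain ⟨hpos, hinf, hlim⟩ := tendsto_ψinv_scaling hν_pos
    (continuous_ψ hd hν_pos hν_mono hint) he (hnorm e he) hA hasymp
  have hfac : ∀ s, 0 < ψinv d ν (1 / s) → ∀ z : EuclideanSpace ℝ (Fin d), νs d ν s z =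
      s / ψinv d ν (1 / s) ^ d * ν (ψinv d ν (1 / s))⁻¹ *
        (ν ((ψinv d ν (1 / s))⁻¹ * ‖z‖) / ν (ψinv d ν (1 / s))⁻¹) := by
    intro s hs z
    have := hν_pos _ (inv_pos.2 hs)
    rw [νs, div_eq_inv_mul ‖z‖, mul_assoc, mul_div_cancel₀ _ this.ne']
  refine tendsto_integral_filter_of_dominated_convergence
    (fun y => (Aconst d α + 1) * (C * (‖y - x‖ ^ (-(d + α - δ)) + ‖y - x‖ ^ (-(d + α + δ)))))
    ?_ ?_ ?_ ?_
  · filter_upwards [hpos] with s hs using (hνs s hs).aestronglyMeasurable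
  · filter_upwards [hpos, hlim.eventually_lt_const (lt_add_one _), hinf.eventually_ge_atTop R,
      hinf.eventually_ge_atTop (R / ε), eventually_ge_atTop 0] with s hs hsA hsR hsε hs0
    filter_upwards [ae_restrict_mem hΓ.measurableSet.compl] with y hy
    have hy' := hsub y hy
    have hr := inv_pos.2 hs
    have hn : 0 < ‖y - x‖ := hε.trans_le hy'
    have hν1 := hν_pos _ hr
    have hν2 := hν_pos _ (mul_pos hr hn)
    have hge : R ≤ (ψinv d ν (1 / s))⁻¹ * ‖y - x‖ :=
      ((div_le_iff₀ hε).1 hsε).trans (by gcongr)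
    have hb := hpot _ _ hge hsR
    rw [mul_div_cancel_left₀ _ hr.ne', ← div_le_iff₀ hν1] at hb
    rw [hfac s hs, Real.norm_of_nonneg (by positivity)]
    gcongr
  · exact (((hpow _ had (by linarith)).add (hpow _ (by linarith) hbd)).const_mul _).const_mul _
  · filter_upwards [ae_restrict_mem hΓ.measurableSet.compl] with y hy
    have hn : y - x ≠ 0 := norm_pos_iff.1 (hε.trans_le (hsub y hy))
    refine (hlim.mul ((tendsto_ratio_mul hA2 hn).comp hinf)).congr' ?_
    filter_upwards [hpos] with s hs using (hfac s hs _).symm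

end
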